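/- Let r>0 and let E(r) ⊂ ℝ³ be the union of the 18 closed segments: the 6 segments joining pairs of the points A=(1,-1,-1), B=(-1,1,-1), C=(-1,-1,1), D=(1,1,1), and the 12 segments joining each of A,B,C,D to the three points among a=(r/3)(-1,1,1), b=(r/3)(1,-1,1), c=(r/3)(1,1,-1), d=(r/3)(-1,-1,-1) whose defining face contains it (namely Ab, Ac, Ad, Ba, Bc, Bd, Ca, Cb, Cd, Da, Db, Dc). Let μ be the 1-dimensional Hausdorff measure restricted to E(r). Let r₁ be the unique positive real root of χ₁(r) = r⁶+2r⁵+r⁴-36r³-45r²-270r-405. A continuous function f:ℝ³→ℝ satisfies f(x) = (1/μ(E(r)))·∫_{E(r)} f(x+s·y) dμ(y) for all x∈ℝ³ and all s>0 if and only if: (when r=r₁) f coincides with the function of a polynomial p∈ℝ[x₁,x₂,x₃] satisfying e₂(∂)p = e₄(∂)p = e₆(∂)p = 0; and (when r≠r₁) f coincides with the function of a polynomial p satisfying e₂(∂)p = e₃(∂)p = e₄(∂)p = 0. -/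

import Mathlib

open MvPolynomial MeasureTheory

noncomputable def dop (φ : MvPolynomial (Fin 3) ℝ) :
    MvPolynomial (Fin 3) ℝ →ₗ[ℝ] MvPolynomial (Fin 3) ℝ :=
  φ.support.sum fun s => φ.coeff s •
    (((pderiv (0 : Fin 3)).toLinearMap ^ s 0) *
     ((pderiv (1 : Fin 3)).toLinearMap ^ s 1) *
     ((pderiv (2 : Fin 3)).toLinearMap ^ s 2))

noncomputable def e2 : MvPolynomial (Fin 3) ℝ := X 0 ^ 2 + X 1 ^ 2 + X 2 ^ 2
noncomputable def e3 : MvPolynomial (Fin 3) ℝ := X 0 * X 1 * X 2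
noncomputable def e4 : MvPolynomial (Fin 3) ℝ :=
  X 1 ^ 2 * X 2 ^ 2 + X 2 ^ 2 * X 0 ^ 2 + X 0 ^ 2 * X 1 ^ 2
noncomputable def e6 : MvPolynomial (Fin 3) ℝ := X 0 ^ 2 * X 1 ^ 2 * X 2 ^ 2

noncomputable abbrev E3 := EuclideanSpace ℝ (Fin 3)

noncomputable def toFn (x : E3) : Fin 3 → ℝ := (WithLp.equiv 2 (Fin 3 → ℝ)) x

noncomputable def pt (u : Fin 3 → ℝ) : E3 := (WithLp.equiv 2 (Fin 3 → ℝ)).symm u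

/-- Vertices of the regular tetrahedron. -/
noncomputable def vA : E3 := pt ![1, -1, -1]
noncomputable def vB : E3 := pt ![-1, 1, -1]
noncomputable def vC : E3 := pt ![-1, -1, 1]
noncomputable def vD : E3 := pt ![1, 1, 1]

/-- Apex vertices of the isohedral triakis tetrahedron with parameter `r`. -/
noncomputable def va (r : ℝ) : E3 := pt ((r / 3) • ![-1, 1, 1])
noncomputable def vb (r : ℝ) : E3 := pt ((r / 3) • ![1, -1, 1])
noncomputable def vc (r : ℝ) : E3 := pt ((r / 3) • ![1, 1, -1])
noncomputable def vd (r : ℝ) : E3 := pt ((r / 3) • ![-1, -1, -1])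

/-- The 1-skeleton (union of the 18 edges) of the isohedral triakis tetrahedron. -/
noncomputable def edgeSet (r : ℝ) : Set E3 :=
  segment ℝ vA vB ∪ segment ℝ vA vC ∪ segment ℝ vA vD ∪
  segment ℝ vB vC ∪ segment ℝ vB vD ∪ segment ℝ vC vD ∪
  segment ℝ vA (vb r) ∪ segment ℝ vA (vc r) ∪ segment ℝ vA (vd r) ∪
  segment ℝ vB (va r) ∪ segment ℝ vB (vc r) ∪ segment ℝ vB (vd r) ∪
  segment ℝ vC (va r) ∪ segment ℝ vC (vb r) ∪ segment ℝ vC (vd r) ∪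
  segment ℝ vD (va r) ∪ segment ℝ vD (vb r) ∪ segment ℝ vD (vc r)

section Operators

variable {M : Type*} [AddCommGroup M] [Module ℝ M]

/-- The action of polynomials in three variables through three commuting endomorphisms. -/
noncomputable def opHom (D : Fin 3 → Module.End ℝ M) (hD : ∀ i j, Commute (D i) (D j)) :
    MvPolynomial (Fin 3) ℝ →ₐ[ℝ] Module.End ℝ M :=
  AddMonoidAlgebra.lift ℝ (Module.End ℝ M) (Fin 3 →₀ ℕ)
    { toFun := fun s => D 0 ^ (s.toAdd 0) * D 1 ^ (s.toAdd 1) * D 2 ^ (s.toAdd 2)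
      map_one' := by simp
      map_mul' := fun s t => by
        simp only [toAdd_mul, Finsupp.add_apply, pow_add]
        have h10 := (hD 0 1).pow_pow (t.toAdd 0) (s.toAdd 1)
        have h20 := (hD 0 2).pow_pow (t.toAdd 0) (s.toAdd 2)
        have h21 := (hD 1 2).pow_pow (t.toAdd 1) (s.toAdd 2)
        simp only [mul_assoc]
        rw [h21.left_comm, h10.left_comm, h20.left_comm] }

theorem opHom_apply (D : Fin 3 → Module.End ℝ M) (hD : ∀ i j, Commute (D i) (D j))
    (φ : MvPolynomial (Fin 3) ℝ) :
    opHom D hD φ = φ.support.sum fun s => φ.coeff s • (D 0 ^ s 0 * D 1 ^ s 1 * D 2 ^ s 2) := by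
  rw [opHom, AddMonoidAlgebra.lift_apply]
  rfl

theorem opHom_X (D : Fin 3 → Module.End ℝ M) (hD : ∀ i j, Commute (D i) (D j)) (i : Fin 3) :
    opHom D hD (X i) = D i := by
  have : (X i : MvPolynomial (Fin 3) ℝ) = AddMonoidAlgebra.single (Finsupp.single i 1) 1 := rfl
  rw [this, opHom, AddMonoidAlgebra.lift_single]
  fin_cases i <;> simp

/-- The ideal of polynomials annihilating `g`. -/
noncomputable def annIdeal (D : Fin 3 → Module.End ℝ M) (hD : ∀ i j, Commute (D i) (D j)) (g : M) :
    Ideal (MvPolynomial (Fin 3) ℝ) where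
  carrier := {φ | opHom D hD φ g = 0}
  add_mem' := fun {a b} ha hb => by
    simp only [Set.mem_ofPred_eq] at *
    simp [ha, hb]
  zero_mem' := by simp
  smul_mem' := fun c x hx => by
    simp only [Set.mem_ofPred_eq] at *
    simp [hx]

theorem opHom_intertwine {N : Type*} [AddCommGroup N] [Module ℝ N]
    (D : Fin 3 → Module.End ℝ M) (hD : ∀ i j, Commute (D i) (D j))
    (D' : Fin 3 → Module.End ℝ N) (hD' : ∀ i j, Commute (D' i) (D' j)) (L : M →ₗ[ℝ] N)
    (h : ∀ i m, L (D i m) = D' i (L m)) (φ : MvPolynomial (Fin 3) ℝ) (m : M) :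
    L (opHom D hD φ m) = opHom D' hD' φ (L m) := by
  induction φ using MvPolynomial.induction_on generalizing m with
  | C a => simp [← MvPolynomial.algebraMap_eq, Module.algebraMap_end_apply]
  | add p q hp hq => simp [hp, hq]
  | mul_X p i hp => simp [hp, opHom_X, h]

end Operators

theorem commute_pderiv (i j : Fin 3) :
    Commute (pderiv (R := ℝ) i).toLinearMap (pderiv (R := ℝ) j).toLinearMap := by
  refine LinearMap.ext fun p => ?_
  have : ⁅pderiv (R := ℝ) i, pderiv (R := ℝ) j⁆ = 0 := by
    apply MvPolynomial.derivation_ext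
    intro k
    simp [Derivation.commutator_apply, pderiv_X, Pi.single_apply, apply_ite]
  have h := congrArg (fun d => d p) this
  simpa [Derivation.commutator_apply, sub_eq_zero] using h

theorem dop_eq_opHom (φ : MvPolynomial (Fin 3) ℝ) :
    dop φ = opHom (fun i => (pderiv i).toLinearMap) commute_pderiv φ := by
  rw [opHom_apply]
  rfl

/-- The linear forms dual to the vertices of the regular tetrahedron. -/
noncomputable def tetraForm : Fin 4 → MvPolynomial (Fin 3) ℝ :=
  ![X 0 - X 1 - X 2, -X 0 + X 1 - X 2, -X 0 - X 1 + X 2, X 0 + X 1 + X 2]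

/-- Power sums of the four tetrahedral forms. -/
noncomputable def tetraPsum (k : ℕ) : MvPolynomial (Fin 3) ℝ := ∑ i, tetraForm i ^ k

theorem tetraForm_pow_four (i : Fin 4) :
    tetraForm i ^ 4 =
      2 * e2 * tetraForm i ^ 2 + 8 * e3 * tetraForm i - (e2 ^ 2 - 4 * e4) := by
  fin_cases i <;> simp [tetraForm, e2, e3, e4] <;> ring

theorem tetraPsum_zero : tetraPsum 0 = 4 := by simp [tetraPsum]

theorem tetraPsum_one : tetraPsum 1 = 0 := by
  simp [tetraPsum, tetraForm, Fin.sum_univ_four]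
  ring

theorem tetraPsum_two : tetraPsum 2 = 4 * e2 := by
  simp [tetraPsum, tetraForm, Fin.sum_univ_four, e2]
  ring

theorem tetraPsum_three : tetraPsum 3 = 24 * e3 := by
  simp [tetraPsum, tetraForm, Fin.sum_univ_four, e3]
  ring

theorem tetraPsum_add_four (k : ℕ) :
    tetraPsum (k + 4) = 2 * e2 * tetraPsum (k + 2) + 8 * e3 * tetraPsum (k + 1)
      - (e2 ^ 2 - 4 * e4) * tetraPsum k := by
  simp only [tetraPsum, Finset.mul_sum, ← Finset.sum_add_distrib, ← Finset.sum_sub_distrib]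
  refine Finset.sum_congr rfl fun i _ => ?_
  rw [pow_add, tetraForm_pow_four]
  ring

/-- The moment polynomials of the edge measure, where `c` is the ratio of the small tetrahedron and
`l` the length of the short edges. -/
noncomputable def edgeMoment (l c : ℝ) (k : ℕ) : MvPolynomial (Fin 3) ℝ :=
  C (1 / ((k : ℝ) + 1)) * ∑ b ∈ Finset.range (k + 1),
    C (√2 + l * c ^ b) * (tetraPsum (k - b) * tetraPsum b - tetraPsum k)

theorem X_pow_six_mem {I : Ideal (MvPolynomial (Fin 3) ℝ)} (h2 : e2 ∈ I) (h4 : e4 ∈ I)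
    (h6 : e6 ∈ I) (i : Fin 3) : (X i : MvPolynomial (Fin 3) ℝ) ^ 6 ∈ I := by
  have : (X i : MvPolynomial (Fin 3) ℝ) ^ 6 = X i ^ 4 * e2 - X i ^ 2 * e4 + e6 := by
    fin_cases i <;> simp [e2, e4, e6] <;> ring
  rw [this]
  exact I.add_mem (I.sub_mem (I.mul_mem_left _ h2) (I.mul_mem_left _ h4)) h6

theorem e6_eq : e6 = e3 ^ 2 := by simp [e6, e3]; ring

theorem tetraPsum_mem {I : Ideal (MvPolynomial (Fin 3) ℝ)} (h2 : e2 ∈ I) (h4 : e4 ∈ I)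
    (h6 : e6 ∈ I) : ∀ k : ℕ, k ≠ 0 → (k ≠ 3 → tetraPsum k ∈ I) ∧ e3 * tetraPsum k ∈ I := by
  have hq : ∀ k, (e2 ^ 2 - 4 * e4) * tetraPsum k ∈ I := fun k =>
    I.mul_mem_right _ (I.sub_mem (I.pow_mem_of_mem h2 2 (by norm_num)) (I.mul_mem_left _ h4))
  have hp : ∀ k, 2 * e2 * tetraPsum k ∈ I := fun k =>
    I.mul_mem_right _ (I.mul_mem_left _ h2)
  intro k
  induction k using Nat.strong_induction_on with
  | _ k ih =>
    intro hk
    suffices h : k ≠ 3 → tetraPsum k ∈ I by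
      refine ⟨h, ?_⟩
      by_cases h3 : k = 3
      · rw [h3, tetraPsum_three, show e3 * (24 * e3) = 24 * e6 by rw [e6_eq]; ring]
        exact I.mul_mem_left _ h6
      · exact I.mul_mem_left _ (h h3)
    intro h3
    match k, hk, h3, ih with
    | 1, _, _, _ => rw [tetraPsum_one]; exact I.zero_mem
    | 2, _, _, _ => rw [tetraPsum_two]; exact I.mul_mem_left _ h2
    | k + 4, _, _, ih =>
      rw [tetraPsum_add_four]
      refine I.sub_mem (I.add_mem (hp _) ?_) (hq _)
      rw [mul_assoc]
      exact I.mul_mem_left _ (ih (k + 1) (by omega) (by omega)).2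

theorem edgeMoment_mem_of_ne_three {I : Ideal (MvPolynomial (Fin 3) ℝ)} (h2 : e2 ∈ I) (h4 : e4 ∈ I)
    (h6 : e6 ∈ I) (l c : ℝ) {k : ℕ} (hk : k ≠ 0) (hk3 : k ≠ 3) : edgeMoment l c k ∈ I := by
  refine I.mul_mem_left _ (I.sum_mem fun b hb => I.mul_mem_left _ (I.sub_mem ?_ ?_))
  · have hb' := Finset.mem_range.1 hb
    have P := tetraPsum_mem h2 h4 h6
    by_cases h0 : b = 0
    · exact I.mul_mem_right _ ((P (k - b) (by omega)).1 (by omega))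
    by_cases h3 : b = 3
    · rw [h3, tetraPsum_three, mul_comm, mul_assoc]
      exact I.mul_mem_left _ (P (k - 3) (by omega)).2
    · exact I.mul_mem_left _ ((P b h0).1 h3)
  · exact (tetraPsum_mem h2 h4 h6 k hk).1 hk3

theorem C_mul_mem_iff {I : Ideal (MvPolynomial (Fin 3) ℝ)} {a : ℝ} (ha : a ≠ 0)
    (p : MvPolynomial (Fin 3) ℝ) : C a * p ∈ I ↔ p ∈ I := by
  refine ⟨fun h => ?_, fun h => I.mul_mem_left _ h⟩
  have := I.mul_mem_left (C a⁻¹) h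
  rwa [← mul_assoc, ← C_mul, inv_mul_cancel₀ ha, C_1, one_mul] at this

theorem edgeMoment_mem_iff {I : Ideal (MvPolynomial (Fin 3) ℝ)} (l c : ℝ) (k : ℕ) :
    edgeMoment l c k ∈ I ↔ ∑ b ∈ Finset.range (k + 1),
      C (√2 + l * c ^ b) * (tetraPsum (k - b) * tetraPsum b - tetraPsum k) ∈ I :=
  C_mul_mem_iff (by positivity) _

theorem edgeMoment_two_mem_iff {I : Ideal (MvPolynomial (Fin 3) ℝ)} {l c : ℝ} (hl : 0 < l)
    (hc : c < 0) : edgeMoment l c 2 ∈ I ↔ e2 ∈ I := by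
  rw [edgeMoment_mem_iff, ← C_mul_mem_iff (p := e2) (a := 4 * (5 * √2 + l * (3 - c + 3 * c ^ 2)))
    (by have := neg_pos.2 hc; have : 0 < 3 - c + 3 * c ^ 2 := by nlinarith
        positivity)]
  simp only [Finset.sum_range_succ, Finset.sum_range_zero, tetraPsum_zero,
    tetraPsum_one, tetraPsum_two, Nat.sub_self, Nat.sub_zero, Nat.reduceSub]
  convert Iff.rfl using 2
  simp only [map_add, map_mul, map_sub, map_pow, map_ofNat]
  ring

theorem edgeMoment_three_mem_iff {I : Ideal (MvPolynomial (Fin 3) ℝ)} {l c : ℝ}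
    (hK : 4 * √2 + l * (3 - c - c ^ 2 + 3 * c ^ 3) ≠ 0) :
    edgeMoment l c 3 ∈ I ↔ e3 ∈ I := by
  rw [edgeMoment_mem_iff, ← C_mul_mem_iff (p := e3) (mul_ne_zero (by norm_num : (24 : ℝ) ≠ 0) hK)]
  simp only [Finset.sum_range_succ, Finset.sum_range_zero, tetraPsum_zero,
    tetraPsum_one, tetraPsum_two, tetraPsum_three, Nat.sub_self, Nat.sub_zero, Nat.reduceSub]
  convert Iff.rfl using 2
  simp only [map_add, map_mul, map_sub, map_pow, map_ofNat]
  ring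

theorem edgeMoment_three_eq_zero {l c : ℝ}
    (hK : 4 * √2 + l * (3 - c - c ^ 2 + 3 * c ^ 3) = 0) : edgeMoment l c 3 = 0 := by
  have h : ∑ b ∈ Finset.range (3 + 1),
      C (√2 + l * c ^ b) * (tetraPsum (3 - b) * tetraPsum b - tetraPsum 3) =
      24 * C (4 * √2 + l * (3 - c - c ^ 2 + 3 * c ^ 3)) * e3 := by
    simp only [Finset.sum_range_succ, Finset.sum_range_zero, tetraPsum_zero,
      tetraPsum_one, tetraPsum_two, tetraPsum_three, Nat.sub_self, Nat.sub_zero, Nat.reduceSub]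
    simp only [map_add, map_mul, map_sub, map_pow, map_ofNat]
    ring
  rw [edgeMoment, h, hK]
  simp

theorem tetraPsum_four : tetraPsum 4 = 4 * e2 ^ 2 + 16 * e4 := by
  rw [show 4 = 0 + 4 from rfl, tetraPsum_add_four, tetraPsum_two, tetraPsum_one, tetraPsum_zero]
  ring

theorem edgeMoment_four_mem_iff {I : Ideal (MvPolynomial (Fin 3) ℝ)} {l c : ℝ} (hl : 0 < l)
    (hc : c < 0) (h2 : e2 ∈ I) : edgeMoment l c 4 ∈ I ↔ e4 ∈ I := by
  rw [edgeMoment_mem_iff,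
    ← C_mul_mem_iff (p := e4) (a := 16 * (3 * √2 + l * (3 - c - c ^ 2 - c ^ 3 + 3 * c ^ 4)))
    (by have : 0 < 3 - c - c ^ 2 - c ^ 3 + 3 * c ^ 4 := by
          have h1 := neg_pos.2 hc
          have h3 : 0 < -c ^ 3 := by have := pow_pos h1 3; linarith [this, show (-c) ^ 3 = -c ^ 3 by ring]
          nlinarith [sq_nonneg (c ^ 2 - 1), sq_nonneg c]
        positivity)]
  simp only [Finset.sum_range_succ, Finset.sum_range_zero, tetraPsum_zero,
    tetraPsum_one, tetraPsum_two, tetraPsum_three, tetraPsum_four, Nat.sub_self, Nat.sub_zero,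
    Nat.reduceSub]
  rw [← I.add_mem_iff_right (b := C (16 * (3 * √2 + l * (3 - c - c ^ 2 - c ^ 3 + 3 * c ^ 4))) * e4)
    (I.mul_mem_right (e2 * 4 * C (7 * √2 + l * (3 - c + 3 * c ^ 2 - c ^ 3 + 3 * c ^ 4))) h2)]
  convert Iff.rfl using 2
  simp only [map_add, map_mul, map_sub, map_pow, map_ofNat]
  ring

theorem tetraPsum_six : tetraPsum 6 = e2 * (4 * e2 ^ 2 + 48 * e4) + 192 * e3 ^ 2 := by
  rw [show 6 = 2 + 4 from rfl, tetraPsum_add_four, tetraPsum_four, tetraPsum_three, tetraPsum_two]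
  ring

theorem edgeMoment_six_mem_iff {I : Ideal (MvPolynomial (Fin 3) ℝ)} {l c : ℝ} (hl : 0 < l)
    (hc : c < 0) (h2 : e2 ∈ I) : edgeMoment l c 6 ∈ I ↔ e6 ∈ I := by
  rw [edgeMoment_mem_iff,
    ← C_mul_mem_iff (p := e6)
      (a := 192 * (4 * √2 + l * (3 - c - c ^ 2 + 2 * c ^ 3 - c ^ 4 - c ^ 5 + 3 * c ^ 6)))
    (by have : 0 < 3 - c - c ^ 2 + 2 * c ^ 3 - c ^ 4 - c ^ 5 + 3 * c ^ 6 := by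
          have h1 : 0 ≤ (-c) * (1 - c ^ 2) ^ 2 := mul_nonneg (neg_pos.2 hc).le (sq_nonneg _)
          nlinarith [sq_nonneg (c ^ 2 - 1), sq_nonneg c,
            mul_nonneg (sq_nonneg c) (sq_nonneg (c ^ 2 - 1))]
        positivity)]
  rw [e6_eq]
  simp only [Finset.sum_range_succ, Finset.sum_range_zero, tetraPsum_zero,
    tetraPsum_one, tetraPsum_two, tetraPsum_three, tetraPsum_four, tetraPsum_six, Nat.sub_self,
    Nat.sub_zero, Nat.reduceSub]
  rw [← I.add_mem_iff_right
    (b := C (192 * (4 * √2 + l * (3 - c - c ^ 2 + 2 * c ^ 3 - c ^ 4 - c ^ 5 + 3 * c ^ 6))) * e3 ^ 2)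
    (I.mul_mem_right ((4 * e2 ^ 2 + 48 * e4) *
      C (√2 + l * (3 - c - c ^ 2 - c ^ 3 - c ^ 4 - c ^ 5 + 3 * c ^ 6)) +
      4 * (4 * e2 ^ 2 + 16 * e4) * C (2 * √2 + l * (c ^ 2 + c ^ 4))) h2)]
  convert Iff.rfl using 2
  simp only [map_add, map_mul, map_sub, map_pow, map_ofNat]
  ring

theorem forall_edgeMoment_mem_iff {I : Ideal (MvPolynomial (Fin 3) ℝ)} {l c : ℝ} (hl : 0 < l)
    (hc : c < 0) (hK : 4 * √2 + l * (3 - c - c ^ 2 + 3 * c ^ 3) ≠ 0) :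
    (∀ k ≠ 0, edgeMoment l c k ∈ I) ↔ e2 ∈ I ∧ e3 ∈ I ∧ e4 ∈ I := by
  constructor
  · intro h
    have h2 := (edgeMoment_two_mem_iff hl hc).1 (h 2 (by norm_num))
    exact ⟨h2, (edgeMoment_three_mem_iff hK).1 (h 3 (by norm_num)),
      (edgeMoment_four_mem_iff hl hc h2).1 (h 4 (by norm_num))⟩
  · rintro ⟨h2, h3, h4⟩ k hk
    by_cases hk3 : k = 3
    · rw [hk3]
      exact (edgeMoment_three_mem_iff hK).2 h3
    · refine edgeMoment_mem_of_ne_three h2 h4 ?_ l c hk hk3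
      rw [e6_eq]
      exact I.pow_mem_of_mem h3 2 (by norm_num)

theorem forall_edgeMoment_mem_iff_of_eq_zero {I : Ideal (MvPolynomial (Fin 3) ℝ)} {l c : ℝ}
    (hl : 0 < l) (hc : c < 0) (hK : 4 * √2 + l * (3 - c - c ^ 2 + 3 * c ^ 3) = 0) :
    (∀ k ≠ 0, edgeMoment l c k ∈ I) ↔ e2 ∈ I ∧ e4 ∈ I ∧ e6 ∈ I := by
  constructor
  · intro h
    have h2 := (edgeMoment_two_mem_iff hl hc).1 (h 2 (by norm_num))
    exact ⟨h2, (edgeMoment_four_mem_iff hl hc h2).1 (h 4 (by norm_num)),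
      (edgeMoment_six_mem_iff hl hc h2).1 (h 6 (by norm_num))⟩
  · rintro ⟨h2, h4, h6⟩ k hk
    by_cases hk3 : k = 3
    · rw [hk3, edgeMoment_three_eq_zero hK]
      exact I.zero_mem
    · exact edgeMoment_mem_of_ne_three h2 h4 h6 l c hk hk3

theorem cubic_coeff_eq_zero_iff {r r₁ : ℝ} (hr : 0 < r) (hr₁pos : 0 < r₁)
    (hr₁root : r₁ ^ 6 + 2 * r₁ ^ 5 + r₁ ^ 4 - 36 * r₁ ^ 3 - 45 * r₁ ^ 2 - 270 * r₁ - 405 = 0)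
    (hr₁uniq : ∀ y : ℝ, 0 < y →
      y ^ 6 + 2 * y ^ 5 + y ^ 4 - 36 * y ^ 3 - 45 * y ^ 2 - 270 * y - 405 = 0 → y = r₁) :
    4 * √2 + √((r ^ 2 - 2 * r + 9) / 3) *
      (3 - (-(r / 3)) - (-(r / 3)) ^ 2 + 3 * (-(r / 3)) ^ 3) = 0 ↔ r = r₁ := by
  have hq : (0 : ℝ) < (r ^ 2 - 2 * r + 9) / 3 := by nlinarith [sq_nonneg (r - 1)]
  have hl := Real.sqrt_pos.2 hq
  have hl2 := Real.sq_sqrt hq.le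
  have h2 := Real.sq_sqrt (show (0 : ℝ) ≤ 2 by norm_num)
  have h2p := Real.sqrt_pos.2 (show (0 : ℝ) < 2 by norm_num)
  set l := √((r ^ 2 - 2 * r + 9) / 3)
  set s := √2
  set K : ℝ := 3 - (-(r / 3)) - (-(r / 3)) ^ 2 + 3 * (-(r / 3)) ^ 3 with hKdef
  have hid : 243 * ((l * K) ^ 2 - 32) =
      (r ^ 6 + 2 * r ^ 5 + r ^ 4 - 36 * r ^ 3 - 45 * r ^ 2 - 270 * r - 405) *
        (r ^ 2 - 2 * r + 3) := by
    rw [mul_pow, hl2, hKdef]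
    ring
  constructor
  · intro h
    apply hr₁uniq r hr
    have h' : (l * K) ^ 2 - 32 = 0 := by
      rw [show l * K = -(4 * s) by linarith]
      nlinarith
    rw [h', mul_zero, eq_comm, mul_eq_zero] at hid
    refine hid.resolve_right ?_
    nlinarith [sq_nonneg (r - 1)]
  · intro h
    subst h
    rw [hr₁root, zero_mul] at hid
    have h3 : 3 < r := by
      by_contra! hle
      nlinarith [pow_pos hr 2, pow_pos hr 3, pow_pos hr 4, pow_pos hr 5, mul_nonneg (pow_pos hr 3).le (sub_nonneg.2 hle), mul_nonneg (pow_pos hr 4).le (sub_nonneg.2 hle), mul_nonneg (pow_pos hr 5).le (sub_nonneg.2 hle)]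
    have hKn : K < 0 := by
      have : K = -(r - 3) * (r ^ 2 + 4 * r + 9) / 9 := by rw [hKdef]; ring
      rw [this]
      have : 0 < (r - 3) * (r ^ 2 + 4 * r + 9) := mul_pos (by linarith) (by positivity)
      linarith
    have hneg : l * K < 0 := mul_neg_of_pos_of_neg hl hKn
    have h0 : (4 * s + l * K) * (l * K - 4 * s) = 0 := by nlinarith
    exact (mul_eq_zero.1 h0).resolve_right (by nlinarith)

/-- The space of smooth real functions on Euclidean three-space. -/
noncomputable def smoothFn : Submodule ℝ (E3 → ℝ) where
  carrier := {g | ContDiff ℝ (⊤ : ℕ∞) g}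
  add_mem' := fun {a b} ha hb => by
    rw [Set.mem_ofPred_eq] at *
    exact ha.add hb
  zero_mem' := by
    rw [Set.mem_ofPred_eq]
    exact contDiff_const
  smul_mem' := fun c g hg => by
    rw [Set.mem_ofPred_eq] at *
    exact contDiff_const.smul hg

theorem mem_smoothFn {g : E3 → ℝ} : g ∈ smoothFn ↔ ContDiff ℝ (⊤ : ℕ∞) g := Iff.rfl

theorem contDiff_smoothFn (g : smoothFn) : ContDiff ℝ (⊤ : ℕ∞) (g : E3 → ℝ) := mem_smoothFn.1 g.2

theorem differentiable_smoothFn (g : smoothFn) : Differentiable ℝ (g : E3 → ℝ) :=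
  (contDiff_smoothFn g).differentiable (by simp)

theorem continuous_smoothFn (g : smoothFn) : Continuous (g : E3 → ℝ) :=
  (contDiff_smoothFn g).continuous

theorem contDiff_fderiv_apply (g : smoothFn) (v : E3) :
    ContDiff ℝ (⊤ : ℕ∞) (fun x => fderiv ℝ (g : E3 → ℝ) x v) :=
  ((contDiff_smoothFn g).fderiv_right (m := (⊤ : ℕ∞)) (by simp)).clm_apply contDiff_const

/-- The directional derivative as an endomorphism of the space of smooth functions. -/
noncomputable def dirDeriv (v : E3) : Module.End ℝ smoothFn where
  toFun g := ⟨fun x => fderiv ℝ (g : E3 → ℝ) x v, contDiff_fderiv_apply g v⟩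
  map_add' := fun g h => by
    ext x
    simp [fderiv_add (differentiable_smoothFn g x) (differentiable_smoothFn h x)]
  map_smul' := fun c g => by
    ext x
    simp [fderiv_const_smul (differentiable_smoothFn g x) c]

theorem dirDeriv_apply (v : E3) (g : smoothFn) (x : E3) :
    (dirDeriv v g : E3 → ℝ) x = fderiv ℝ (g : E3 → ℝ) x v := rfl

theorem commute_dirDeriv (v w : E3) : Commute (dirDeriv v) (dirDeriv w) := by
  refine LinearMap.ext fun g => Subtype.ext (funext fun x => ?_)
  have hd : DifferentiableAt ℝ (fderiv ℝ (g : E3 → ℝ)) x :=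
    ((contDiff_smoothFn g).fderiv_right (m := (⊤ : ℕ∞)) (by simp)).differentiable (by simp) x
  have key : ∀ a b : E3, (dirDeriv a (dirDeriv b g) : E3 → ℝ) x =
      fderiv ℝ (fderiv ℝ (g : E3 → ℝ)) x a b := by
    intro a b
    rw [dirDeriv_apply]
    change fderiv ℝ (fun y => fderiv ℝ (g : E3 → ℝ) y b) x a = _
    rw [fderiv_clm_apply hd (differentiableAt_const b)]
    simp
  have hs : IsSymmSndFDerivAt ℝ (g : E3 → ℝ) x :=
    (contDiff_smoothFn g).contDiffAt.isSymmSndFDerivAt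
      (by simpa using WithTop.coe_le_coe.2 (le_top : (2 : ℕ∞) ≤ ⊤))
  change (dirDeriv v (dirDeriv w g) : E3 → ℝ) x = (dirDeriv w (dirDeriv v g) : E3 → ℝ) x
  rw [key, key]
  exact hs v w

theorem dirDeriv_eq_sum (y : E3) :
    dirDeriv y = ∑ i, y i • dirDeriv (EuclideanSpace.single i 1) := by
  refine LinearMap.ext fun g => Subtype.ext (funext fun x => ?_)
  have hy : y = ∑ i, y i • (EuclideanSpace.single i (1 : ℝ) : E3) := by
    ext j
    simp [Fin.sum_univ_three]
    fin_cases j <;> simp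
  rw [dirDeriv_apply]
  conv_lhs => rw [hy]
  simp [Fin.sum_univ_three, dirDeriv_apply]

/-- The action of polynomials on smooth functions as differential operators. -/
noncomputable def smoothOp : MvPolynomial (Fin 3) ℝ →ₐ[ℝ] Module.End ℝ smoothFn :=
  opHom (fun i => dirDeriv (EuclideanSpace.single i 1)) fun _ _ => commute_dirDeriv _ _

/-- The linear form with coefficient vector `y`. -/
noncomputable def linForm (y : E3) : MvPolynomial (Fin 3) ℝ := ∑ i, C (y i) * X i

theorem smoothOp_linForm (y : E3) : smoothOp (linForm y) = dirDeriv y := by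
  rw [dirDeriv_eq_sum, linForm, map_sum]
  refine Finset.sum_congr rfl fun i _ => ?_
  rw [map_mul, ← MvPolynomial.algebraMap_eq, AlgHom.commutes, smoothOp, opHom_X,
    Algebra.smul_def]

theorem linForm_single (i : Fin 3) : linForm (EuclideanSpace.single i 1) = X i := by
  rw [linForm, Finset.sum_eq_single i] <;> simp +contextual

theorem hasDerivAt_line (g : smoothFn) (x v : E3) (t : ℝ) :
    HasDerivAt (fun t : ℝ => (g : E3 → ℝ) (x + t • v)) ((dirDeriv v g : E3 → ℝ) (x + t • v)) t := by
  have h1 : HasDerivAt (fun t : ℝ => x + t • v) v t := by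
    simpa using ((hasDerivAt_id t).smul_const v).const_add x
  exact ((differentiable_smoothFn g) (x + t • v)).hasFDerivAt.comp_hasDerivAt t h1

theorem taylor_line (v : E3) (N : ℕ) : ∀ g : smoothFn, (dirDeriv v ^ N) g = 0 →
    ∀ (x : E3) (t : ℝ), (g : E3 → ℝ) (x + t • v) =
      ∑ k ∈ Finset.range N, t ^ k / (k.factorial : ℝ) * ((dirDeriv v ^ k) g : E3 → ℝ) x := by
  induction N with
  | zero =>
    intro g hg x t
    have : g = 0 := by simpa using hg
    simp [this]
  | succ N ih =>
    intro g hg x t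
    have ih' := ih (dirDeriv v g) (by simpa [pow_succ] using hg) x
    have hsum : ∀ t : ℝ, HasDerivAt (fun t : ℝ => ∑ k ∈ Finset.range (N + 1),
        t ^ k / (k.factorial : ℝ) * ((dirDeriv v ^ k) g : E3 → ℝ) x)
        (∑ k ∈ Finset.range N,
          t ^ k / (k.factorial : ℝ) * ((dirDeriv v ^ k) (dirDeriv v g) : E3 → ℝ) x) t := by
      intro t
      simp only [Finset.sum_range_succ', pow_zero]
      have h : HasDerivAt (fun t : ℝ => ∑ k ∈ Finset.range N,
        t ^ (k + 1) / ((k + 1).factorial : ℝ) * ((dirDeriv v ^ (k + 1)) g : E3 → ℝ) x)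
        (∑ k ∈ Finset.range N,
          t ^ k / (k.factorial : ℝ) * ((dirDeriv v ^ k) (dirDeriv v g) : E3 → ℝ) x) t := by
        refine HasDerivAt.fun_sum fun k _ => ?_
        have h1 := ((hasDerivAt_pow (k + 1) t).div_const ((k + 1).factorial : ℝ)).mul_const
          (((dirDeriv v ^ (k + 1)) g : E3 → ℝ) x)
        refine h1.congr_deriv ?_
        rw [pow_succ (dirDeriv v), Module.End.mul_apply, Nat.factorial_succ]
        push_cast
        have : (k.factorial : ℝ) ≠ 0 := by positivity
        field_simp
      exact h.add_const _
    have hdiff : ∀ t : ℝ, HasDerivAt (fun t : ℝ => (g : E3 → ℝ) (x + t • v) -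
        ∑ k ∈ Finset.range (N + 1),
          t ^ k / (k.factorial : ℝ) * ((dirDeriv v ^ k) g : E3 → ℝ) x) 0 t := by
      intro t
      have := (hasDerivAt_line g x v t).sub (hsum t)
      rwa [ih' t, sub_self] at this
    have hconst := is_const_of_deriv_eq_zero (fun t => (hdiff t).differentiableAt)
      (fun t => (hdiff t).deriv) t 0
    have h0 : ∑ k ∈ Finset.range (N + 1),
        (0 : ℝ) ^ k / (k.factorial : ℝ) * ((dirDeriv v ^ k) g : E3 → ℝ) x = (g : E3 → ℝ) x := by
      rw [Finset.sum_eq_single 0] <;> simp +contextual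
    simp only [h0, zero_smul, add_zero, sub_self] at hconst
    linarith

/-- Polynomials as smooth functions. -/
noncomputable def polyFn : MvPolynomial (Fin 3) ℝ →ₗ[ℝ] smoothFn where
  toFun p := ⟨fun x => eval (toFn x) p, by
    change ContDiff ℝ (⊤ : ℕ∞) fun x => eval (toFn x) p
    induction p using MvPolynomial.induction_on with
    | C a => simpa using contDiff_const
    | add p q hp hq => simpa using hp.add hq
    | mul_X p i hp =>
      simp only [map_mul, eval_X]
      exact hp.mul (EuclideanSpace.proj (𝕜 := ℝ) i).contDiff⟩
  map_add' := fun p q => by ext x; simp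
  map_smul' := fun c p => by ext x; simp [smul_eval]

theorem polyFn_apply (p : MvPolynomial (Fin 3) ℝ) (x : E3) :
    (polyFn p : E3 → ℝ) x = eval (toFn x) p := rfl

theorem polyFn_injective : Function.Injective polyFn := by
  intro p q h
  refine MvPolynomial.funext fun u => ?_
  have := congrArg (fun g : smoothFn => (g : E3 → ℝ) (pt u)) h
  simpa [polyFn_apply, toFn, pt] using this

theorem polyFn_pderiv (i : Fin 3) (p : MvPolynomial (Fin 3) ℝ) :
    polyFn (pderiv i p) = dirDeriv (EuclideanSpace.single i 1) (polyFn p) := by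
  refine Subtype.ext (funext fun x => ?_)
  rw [dirDeriv_apply, polyFn_apply]
  change _ = fderiv ℝ (fun x => eval (toFn x) p) x _
  have hd : ∀ p, DifferentiableAt ℝ (fun x : E3 => eval (toFn x) p) x := fun p =>
    differentiable_smoothFn (polyFn p) x
  induction p using MvPolynomial.induction_on with
  | C a => simp
  | add p q hp hq =>
    simp only [map_add, hp, hq]
    rw [fderiv_fun_add (hd p) (hd q)]
    rfl
  | mul_X p j hp =>
    have hX : HasFDerivAt (fun x : E3 => toFn x j) (EuclideanSpace.proj (𝕜 := ℝ) j : E3 →L[ℝ] ℝ) x :=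
      (EuclideanSpace.proj (𝕜 := ℝ) j : E3 →L[ℝ] ℝ).hasFDerivAt
    simp only [map_mul, eval_X, Derivation.leibniz, smul_eq_mul, map_add, hp, pderiv_X]
    rw [fderiv_fun_mul (hd p) hX.differentiableAt, hX.fderiv]
    by_cases h : j = i
    · subst h; simp
    · simp [h]

theorem polyFn_dop (φ p : MvPolynomial (Fin 3) ℝ) :
    polyFn (dop φ p) = smoothOp φ (polyFn p) := by
  rw [dop_eq_opHom]
  exact opHom_intertwine _ _ _ _ polyFn (fun i m => polyFn_pderiv i m) φ p

theorem dop_eq_zero_iff (φ p : MvPolynomial (Fin 3) ℝ) :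
    dop φ p = 0 ↔ smoothOp φ (polyFn p) = 0 := by
  rw [← polyFn_dop, map_eq_zero_iff _ polyFn_injective]

theorem integrable_of_continuous_of_ae_mem {ν : Measure E3} [IsFiniteMeasure ν] {K : Set E3}
    (hK : IsCompact K) (hν : ∀ᵐ y ∂ν, y ∈ K) {F : E3 → ℝ} (hF : Continuous F) :
    Integrable F ν := by
  obtain ⟨B, hB⟩ := hK.exists_bound_of_continuousOn hF.continuousOn
  exact Integrable.of_bound hF.aestronglyMeasurable B (hν.mono fun y hy => hB y hy)

theorem continuous_dirDeriv_pow (k : ℕ) : ∀ g : smoothFn,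
    Continuous fun q : E3 × E3 => ((dirDeriv q.1 ^ k) g : E3 → ℝ) q.2 := by
  induction k with
  | zero => exact fun g => (continuous_smoothFn g).comp continuous_snd
  | succ k ih =>
    intro g
    have h : (fun q : E3 × E3 => ((dirDeriv q.1 ^ (k + 1)) g : E3 → ℝ) q.2) =
        fun q : E3 × E3 => ∑ i, q.1 i *
          ((dirDeriv q.1 ^ k) (dirDeriv (EuclideanSpace.single i 1) g) : E3 → ℝ) q.2 := by
      funext q
      rw [pow_succ, Module.End.mul_apply]
      conv_lhs => rw [show dirDeriv q.1 g = ∑ i, q.1 i • dirDeriv (EuclideanSpace.single i 1) g by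
        rw [dirDeriv_eq_sum]; simp]
      simp [Fin.sum_univ_three]
    rw [h]
    refine continuous_finsetSum _ fun i _ => Continuous.mul ?_ (ih _)
    exact (EuclideanSpace.proj (𝕜 := ℝ) i : E3 →L[ℝ] ℝ).continuous.comp continuous_fst

section MeanValue

variable {ν : Measure E3} [IsFiniteMeasure ν] {K : Set E3}

theorem hasDerivAt_integral_dirDeriv_pow (hK : IsCompact K) (hν : ∀ᵐ y ∂ν, y ∈ K)
    (g : smoothFn) (k : ℕ) (x : E3) (s : ℝ) :
    HasDerivAt (fun s : ℝ => ∫ y, ((dirDeriv y ^ k) g : E3 → ℝ) (x + s • y) ∂ν)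
      (∫ y, ((dirDeriv y ^ (k + 1)) g : E3 → ℝ) (x + s • y) ∂ν) s := by
  have hc : ∀ k, Continuous fun q : ℝ × E3 =>
      ((dirDeriv q.2 ^ k) g : E3 → ℝ) (x + q.1 • q.2) := fun k =>
    (continuous_dirDeriv_pow k g).comp (by fun_prop : Continuous fun q : ℝ × E3 =>
      ((q.2, x + q.1 • q.2) : E3 × E3))
  have hcy : ∀ k (s : ℝ), Continuous fun y : E3 =>
      ((dirDeriv y ^ k) g : E3 → ℝ) (x + s • y) := fun k s =>
    (hc k).comp (by fun_prop : Continuous fun y : E3 => ((s, y) : ℝ × E3))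
  obtain ⟨B, hB⟩ := ((isCompact_closedBall s 1).prod hK).exists_bound_of_continuousOn
    (hc (k + 1)).continuousOn
  refine (hasDerivAt_integral_of_dominated_loc_of_deriv_le (bound := fun _ => B)
    (F' := fun s y => ((dirDeriv y ^ (k + 1)) g : E3 → ℝ) (x + s • y))
    (Metric.closedBall_mem_nhds s one_pos)
    (Filter.Eventually.of_forall fun s => (hcy k s).aestronglyMeasurable)
    (integrable_of_continuous_of_ae_mem hK hν (hcy k s)) (hcy (k + 1) s).aestronglyMeasurable
    (hν.mono fun y hy t ht => hB (t, y) ⟨ht, hy⟩) (integrable_const B)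
    (Filter.Eventually.of_forall fun y t _ => ?_)).2
  rw [pow_succ', Module.End.mul_apply]
  exact hasDerivAt_line _ x y t

theorem integral_dirDeriv_pow_eq_zero (hK : IsCompact K) (hν : ∀ᵐ y ∂ν, y ∈ K)
    (g : smoothFn) (x : E3) (m : ℝ)
    (hg : ∀ s : ℝ, 0 < s → ∫ y, (g : E3 → ℝ) (x + s • y) ∂ν = m) (k : ℕ) (hk : k ≠ 0) :
    ∫ y, ((dirDeriv y ^ k) g : E3 → ℝ) x ∂ν = 0 := by
  set H : ℕ → ℝ → ℝ := fun k s => ∫ y, ((dirDeriv y ^ k) g : E3 → ℝ) (x + s • y) ∂ν with hH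
  have hd : ∀ k s, HasDerivAt (H k) (H (k + 1) s) s := fun k s =>
    hasDerivAt_integral_dirDeriv_pow hK hν g k x s
  have step : ∀ k (m : ℝ), (∀ s, 0 < s → H k s = m) → ∀ s, 0 < s → H (k + 1) s = 0 := by
    intro k m hm s hs
    refine (hd k s).unique ((hasDerivAt_const s m).congr_of_eventuallyEq ?_)
    filter_upwards [lt_mem_nhds hs] with t ht using hm t ht
  have hpos : ∀ k s, 0 < s → H (k + 1) s = 0 := by
    intro k
    induction k with
    | zero => exact step 0 m fun s hs => by simpa [hH] using hg s hs
    | succ k ih => exact step (k + 1) 0 ih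
  obtain ⟨k, rfl⟩ := Nat.exists_eq_succ_of_ne_zero hk
  have hcont : Continuous (H (k + 1)) :=
    continuous_iff_continuousAt.2 fun s => (hd (k + 1) s).continuousAt
  have hlim : Filter.Tendsto (H (k + 1)) (nhdsWithin 0 (Set.Ioi 0)) (nhds (H (k + 1) 0)) :=
    hcont.continuousAt.tendsto.mono_left nhdsWithin_le_nhds
  have hlim0 : Filter.Tendsto (H (k + 1)) (nhdsWithin 0 (Set.Ioi 0)) (nhds 0) :=
    tendsto_const_nhds.congr' (by
      filter_upwards [self_mem_nhdsWithin] with s hs using (hpos k s hs).symm)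
  simpa [hH] using tendsto_nhds_unique hlim hlim0

theorem integral_line_eq_of_X_pow_six (hK : IsCompact K) (hν : ∀ᵐ y ∂ν, y ∈ K)
    (g : smoothFn) (hX : ∀ i, smoothOp (X i ^ 6) g = 0)
    (x : E3) (h : ∀ k ≠ 0, ∫ y, ((dirDeriv y ^ k) g : E3 → ℝ) x ∂ν = 0) (s : ℝ) :
    ∫ y, (g : E3 → ℝ) (x + s • y) ∂ν = (g : E3 → ℝ) x * ν.real Set.univ := by
  have hn : ∀ y, (dirDeriv y ^ 16) g = 0 := by
    intro y
    rw [← smoothOp_linForm, ← map_pow]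
    change linForm y ^ 16 ∈ annIdeal _ _ g
    have hXi : ∀ i, (C (y i) * X i) ^ 6 ∈ annIdeal
        (fun i => dirDeriv (EuclideanSpace.single i 1)) (fun _ _ => commute_dirDeriv _ _) g := by
      intro i
      rw [mul_pow]
      exact Ideal.mul_mem_left _ _ (hX i)
    rw [linForm, Fin.sum_univ_three]
    refine Ideal.add_pow_mem_of_pow_mem_of_le (m := 11) (n := 6) _ ?_ (hXi 2) (by norm_num)
    exact Ideal.add_pow_mem_of_pow_mem_of_le (m := 6) (n := 6) _ (hXi 0) (hXi 1) (by norm_num)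
  simp_rw [fun y => taylor_line y 16 g (hn y) x s]
  rw [integral_finsetSum]
  · rw [Finset.sum_eq_single 0]
    · simp [mul_comm]
    · intro k _ hk
      rw [integral_const_mul, h k hk, mul_zero]
    · simp
  · intro k _
    refine Integrable.const_mul (integrable_of_continuous_of_ae_mem hK hν ?_) _
    exact (continuous_dirDeriv_pow k g).comp (by fun_prop : Continuous fun y : E3 =>
      ((y, x) : E3 × E3))

end MeanValue

/-- Functions of polynomials of degree at most five in each variable. -/
noncomputable def boxPoly : Submodule ℝ (E3 → ℝ) :=
  (Submodule.span ℝ (Set.range fun s : Fin 6 × Fin 6 × Fin 6 =>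
    (X 0 ^ (s.1 : ℕ) * X 1 ^ (s.2.1 : ℕ) * X 2 ^ (s.2.2 : ℕ) : MvPolynomial (Fin 3) ℝ))).map
    (smoothFn.subtype ∘ₗ polyFn)

instance finiteDimensional_boxPoly : FiniteDimensional ℝ boxPoly := by
  have := FiniteDimensional.span_of_finite ℝ (Set.finite_range fun s : Fin 6 × Fin 6 × Fin 6 =>
    (X 0 ^ (s.1 : ℕ) * X 1 ^ (s.2.1 : ℕ) * X 2 ^ (s.2.2 : ℕ) : MvPolynomial (Fin 3) ℝ))
  exact Module.Finite.map _ _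

theorem mem_boxPoly_of_X_pow_six (g : smoothFn) (hX : ∀ i, smoothOp (X i ^ 6) g = 0) :
    (g : E3 → ℝ) ∈ boxPoly := by
  have hD : ∀ i, dirDeriv (EuclideanSpace.single i 1) = smoothOp (X i) := fun i => by
    rw [← linForm_single, smoothOp_linForm]
  have hT : ∀ (i : Fin 3) (φ : MvPolynomial (Fin 3) ℝ) (x : E3) (t : ℝ),
      (smoothOp φ g : E3 → ℝ) (x + t • EuclideanSpace.single i 1) =
      ∑ k ∈ Finset.range 6, t ^ k / (k.factorial : ℝ) * (smoothOp (X i ^ k * φ) g : E3 → ℝ) x := by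
    intro i φ x t
    have := taylor_line (EuclideanSpace.single i 1) 6 (smoothOp φ g) (by
      rw [hD, ← map_pow, ← Module.End.mul_apply, ← map_mul, mul_comm, map_mul,
        Module.End.mul_apply, hX, map_zero]) x t
    simpa only [hD, ← map_pow, ← Module.End.mul_apply, ← map_mul] using this
  have hg : (g : E3 → ℝ) = ∑ m ∈ Finset.range 6, ∑ l ∈ Finset.range 6, ∑ k ∈ Finset.range 6,
      (1 / (m.factorial : ℝ) * (1 / (l.factorial : ℝ)) * (1 / (k.factorial : ℝ)) *
        (smoothOp (X 0 ^ k * (X 1 ^ l * (X 2 ^ m * 1))) g : E3 → ℝ) 0) •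
      (smoothFn.subtype ∘ₗ polyFn) (X 0 ^ k * X 1 ^ l * X 2 ^ m) := by
    funext x
    have hx : x = ((0 + x 0 • EuclideanSpace.single 0 1) + x 1 • EuclideanSpace.single 1 1) +
        x 2 • EuclideanSpace.single 2 1 := by
      ext j
      fin_cases j <;> simp
    have h1 := hT 2 1 ((0 + x 0 • EuclideanSpace.single 0 1) + x 1 • EuclideanSpace.single 1 1) (x 2)
    rw [← hx, map_one, Module.End.one_apply] at h1
    rw [h1]
    simp only [hT 1, hT 0, Finset.sum_apply, Pi.smul_apply, Finset.mul_sum]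
    refine Finset.sum_congr rfl fun m _ => Finset.sum_congr rfl fun l _ =>
      Finset.sum_congr rfl fun k _ => ?_
    have : (smoothFn.subtype ∘ₗ polyFn) (X 0 ^ k * X 1 ^ l * X 2 ^ m) x =
        x 0 ^ k * x 1 ^ l * x 2 ^ m := by
      change eval (toFn x) _ = _
      simp
      rfl
    rw [this, smul_eq_mul]
    ring
  rw [hg]
  refine Submodule.sum_mem _ fun m hm => Submodule.sum_mem _ fun l hl =>
    Submodule.sum_mem _ fun k hk => Submodule.smul_mem _ _ (Submodule.mem_map_of_mem ?_)
  exact Submodule.subset_span ⟨(⟨k, Finset.mem_range.1 hk⟩, ⟨l, Finset.mem_range.1 hl⟩,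
    ⟨m, Finset.mem_range.1 hm⟩), rfl⟩

theorem exists_eval_of_mem_boxPoly {f : E3 → ℝ} (hf : f ∈ boxPoly) :
    ∃ p : MvPolynomial (Fin 3) ℝ, f = polyFn p := by
  obtain ⟨p, -, rfl⟩ := hf
  exact ⟨p, rfl⟩

section Mollify

variable {ν : Measure E3} [IsFiniteMeasure ν] {K : Set E3}

/-- The mollification of a continuous function by a bump function. -/
noncomputable def mollify (φ : ContDiffBump (0 : E3)) {f : E3 → ℝ} (hf : Continuous f) : smoothFn :=
  ⟨convolution (φ.normed volume) f (ContinuousLinearMap.lsmul ℝ ℝ) volume,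
    mem_smoothFn.2 (φ.hasCompactSupport_normed.contDiff_convolution_left _ φ.contDiff_normed
      hf.locallyIntegrable)⟩

theorem mollify_apply (φ : ContDiffBump (0 : E3)) {f : E3 → ℝ} (hf : Continuous f) (x : E3) :
    (mollify φ hf : E3 → ℝ) x = ∫ z, φ.normed volume z * f (x - z) := rfl

theorem integral_mollify (hK : IsCompact K) (hν : ∀ᵐ y ∂ν, y ∈ K) (φ : ContDiffBump (0 : E3))
    {f : E3 → ℝ} (hf : Continuous f) (m : ℝ)
    (h : ∀ (x : E3) (s : ℝ), 0 < s → ∫ y, f (x + s • y) ∂ν = f x * m) (x : E3) (s : ℝ)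
    (hs : 0 < s) :
    ∫ y, (mollify φ hf : E3 → ℝ) (x + s • y) ∂ν = (mollify φ hf : E3 → ℝ) x * m := by
  have hφc : Continuous (φ.normed (volume : Measure E3)) := φ.continuous_normed
  have hc : Continuous fun q : E3 × E3 => φ.normed volume q.2 * f (x + s • q.1 - q.2) := by
    fun_prop
  have hint : Integrable (fun q : E3 × E3 => φ.normed volume q.2 * f (x + s • q.1 - q.2))
      (ν.prod volume) := by
    have hcs : IsCompact (tsupport (φ.normed (volume : Measure E3))) := φ.hasCompactSupport_normed
    obtain ⟨B, hB⟩ := (hK.prod hcs).exists_bound_of_continuousOn hc.continuousOn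
    have hon : IntegrableOn (fun q : E3 × E3 => φ.normed volume q.2 * f (x + s • q.1 - q.2))
        (K ×ˢ tsupport (φ.normed (volume : Measure E3))) (ν.prod volume) := by
      refine IntegrableOn.of_bound ?_ hc.aestronglyMeasurable B ?_
      · rw [Measure.prod_prod]
        exact ENNReal.mul_lt_top (measure_lt_top _ _) hcs.measure_lt_top
      · exact (ae_restrict_iff' (hK.prod hcs).measurableSet).2
          (Filter.Eventually.of_forall fun q hq => hB q hq)
    refine hon.integrable_of_ae_notMem_eq_zero ?_
    have hae : ∀ᵐ q ∂(ν.prod (volume : Measure E3)), q.1 ∈ K :=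
      Measure.quasiMeasurePreserving_fst.ae hν
    filter_upwards [hae] with q hq hq'
    have : q.2 ∉ tsupport (φ.normed (volume : Measure E3)) := fun h => hq' ⟨hq, h⟩
    rw [image_eq_zero_of_notMem_tsupport this, zero_mul]
  simp only [mollify_apply]
  rw [integral_integral_swap hint, ← integral_mul_const]
  refine integral_congr_ae (Filter.Eventually.of_forall fun z => ?_)
  simp only
  rw [integral_const_mul, mul_assoc, ← h (x - z) s hs]
  congr 2
  funext y
  congr 1
  abel

theorem mem_boxPoly_of_mollify {f : E3 → ℝ} (hf : Continuous f)
    (h : ∀ φ : ContDiffBump (0 : E3), (mollify φ hf : E3 → ℝ) ∈ boxPoly) : f ∈ boxPoly := by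
  have hcl : IsClosed (boxPoly : Set (E3 → ℝ)) := Submodule.closed_of_finiteDimensional _
  let φ : ℕ → ContDiffBump (0 : E3) := fun n =>
    ⟨1 / ((n : ℝ) + 1) / 2, 1 / ((n : ℝ) + 1), by positivity, half_lt_self (by positivity)⟩
  refine hcl.mem_of_tendsto (f := fun n => (mollify (φ n) hf : E3 → ℝ)) (b := Filter.atTop) ?_
    (Filter.Eventually.of_forall fun n => h _)
  refine tendsto_pi_nhds.2 fun x => ?_
  exact ContDiffBump.convolution_tendsto_right_of_continuous (φ := φ)
    tendsto_one_div_add_atTop_nhds_zero_nat hf x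

end Mollify

theorem integral_one_sub_pow_mul_pow (a : ℕ) : ∀ b : ℕ,
    ∫ t in (0 : ℝ)..1, (1 - t) ^ a * t ^ b =
      (a.factorial * b.factorial : ℝ) / ((a + b + 1).factorial : ℝ) := by
  induction a with
  | zero =>
    intro b
    have : (b.factorial : ℝ) ≠ 0 := by positivity
    simp [Nat.factorial_succ]
    field_simp
  | succ a ih =>
    intro b
    have h1 : ∀ t ∈ Set.uIcc (0 : ℝ) 1,
        HasDerivAt (fun t : ℝ => (1 - t) ^ (a + 1)) (-((a + 1 : ℝ) * (1 - t) ^ a)) t := by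
      intro t _
      have := ((hasDerivAt_id t).const_sub 1).pow (a + 1)
      refine this.congr_deriv ?_
      simp
    have h2 : ∀ t ∈ Set.uIcc (0 : ℝ) 1,
        HasDerivAt (fun t : ℝ => t ^ (b + 1) / (b + 1 : ℝ)) (t ^ b) t := by
      intro t _
      refine ((hasDerivAt_pow (b + 1) t).div_const (b + 1 : ℝ)).congr_deriv ?_
      have : (b + 1 : ℝ) ≠ 0 := by positivity
      push_cast
      field_simp
    rw [intervalIntegral.integral_mul_deriv_eq_deriv_mul h1 h2
      (Continuous.intervalIntegrable (by fun_prop) _ _)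
      (Continuous.intervalIntegrable (by fun_prop) _ _)]
    have h3 : ∀ t : ℝ, -((a + 1 : ℝ) * (1 - t) ^ a) * (t ^ (b + 1) / (b + 1 : ℝ)) =
        -((a + 1 : ℝ) / (b + 1)) * ((1 - t) ^ a * t ^ (b + 1)) := fun t => by ring
    simp_rw [h3]
    rw [intervalIntegral.integral_const_mul, ih (b + 1), show a + 1 + b + 1 = a + (b + 1) + 1 by ring,
      Nat.factorial_succ a, Nat.factorial_succ b]
    have : (b + 1 : ℝ) ≠ 0 := by positivity
    push_cast
    field_simp
    simp

theorem choose_mul_integral_one_sub_pow_mul_pow {k a : ℕ} (ha : a ≤ k) :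
    (k.choose a : ℝ) * ∫ t in (0 : ℝ)..1, (1 - t) ^ a * t ^ (k - a) = 1 / ((k : ℝ) + 1) := by
  rw [integral_one_sub_pow_mul_pow, Nat.add_sub_cancel' ha, Nat.factorial_succ,
    ← Nat.choose_mul_factorial_mul_factorial ha]
  have h1 : (a.factorial : ℝ) ≠ 0 := by positivity
  have h2 : ((k - a).factorial : ℝ) ≠ 0 := by positivity
  have h3 : (k.choose a : ℝ) ≠ 0 := by exact_mod_cast (Nat.choose_pos ha).ne'
  push_cast
  field_simp

theorem linForm_lineMap (P Q : E3) (t : ℝ) :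
    linForm (AffineMap.lineMap P Q t) = C (1 - t) * linForm P + C t * linForm Q := by
  simp only [linForm, AffineMap.lineMap_apply_module, Finset.mul_sum, ← Finset.sum_add_distrib]
  refine Finset.sum_congr rfl fun i _ => ?_
  simp
  ring

theorem integral_dirDeriv_pow_lineMap (g : smoothFn) (x P Q : E3) (k : ℕ) :
    ∫ t in (0 : ℝ)..1, ((dirDeriv (AffineMap.lineMap P Q t) ^ k) g : E3 → ℝ) x =
      (smoothOp (C (1 / ((k : ℝ) + 1)) *
        ∑ a ∈ Finset.range (k + 1), linForm P ^ a * linForm Q ^ (k - a)) g : E3 → ℝ) x := by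
  have hexp : ∀ t : ℝ, ((dirDeriv (AffineMap.lineMap P Q t) ^ k) g : E3 → ℝ) x =
      ∑ a ∈ Finset.range (k + 1), ((1 - t) ^ a * t ^ (k - a)) * ((k.choose a : ℝ) *
        (smoothOp (linForm P ^ a * linForm Q ^ (k - a)) g : E3 → ℝ) x) := by
    intro t
    rw [← smoothOp_linForm, ← map_pow, linForm_lineMap, add_pow]
    simp only [map_sum, LinearMap.sum_apply, Submodule.coe_sum, Finset.sum_apply]
    refine Finset.sum_congr rfl fun a _ => ?_
    have : (C (1 - t) * linForm P) ^ a * (C t * linForm Q) ^ (k - a) *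
        (k.choose a : MvPolynomial (Fin 3) ℝ) =
        ((1 - t) ^ a * t ^ (k - a) * (k.choose a : ℝ)) • (linForm P ^ a * linForm Q ^ (k - a)) := by
      rw [smul_eq_C_mul]
      simp only [map_mul, map_pow, map_natCast]
      ring
    rw [this, map_smul]
    simp [mul_assoc]
  simp_rw [hexp]
  rw [intervalIntegral.integral_finsetSum
    (fun a _ => Continuous.intervalIntegrable (by fun_prop) _ _)]
  rw [← smul_eq_C_mul, map_smul]
  simp only [map_sum, LinearMap.sum_apply, Submodule.coe_sum, Finset.sum_apply,
    LinearMap.smul_apply, Submodule.coe_smul, Pi.smul_apply, smul_eq_mul, Finset.mul_sum]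
  refine Finset.sum_congr rfl fun a ha => ?_
  rw [intervalIntegral.integral_mul_const,
    ← choose_mul_integral_one_sub_pow_mul_pow (Finset.mem_range_succ_iff.1 ha)]
  ring

theorem restrict_segment (P Q : E3) :
    (μH[1] : Measure E3).restrict (segment ℝ P Q) =
      nndist P Q • (volume.restrict (Set.Icc (0 : ℝ) 1)).map (AffineMap.lineMap P Q) := by
  have hm : Measurable (AffineMap.lineMap P Q : ℝ → E3) :=
    (AffineMap.lineMap_continuous (R := ℝ)).measurable
  ext s hs
  rw [Measure.restrict_apply hs, Measure.smul_apply, Measure.map_apply hm hs,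
    Measure.restrict_apply (hm hs), segment_eq_image_lineMap, ← hausdorffMeasure_real,
    ← hausdorffMeasure_lineMap_image, Set.image_preimage_inter]

theorem integral_segment (P Q : E3) {F : E3 → ℝ} (hF : Continuous F) :
    ∫ y in segment ℝ P Q, F y ∂(μH[1] : Measure E3) =
      dist P Q * ∫ t in (0 : ℝ)..1, F (AffineMap.lineMap P Q t) := by
  rw [restrict_segment, integral_smul_nnreal_measure, integral_map
    (AffineMap.lineMap_continuous (R := ℝ)).aemeasurable hF.aestronglyMeasurable,
    integral_Icc_eq_integral_Ioc, ← intervalIntegral.integral_of_le zero_le_one, NNReal.smul_def,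
    coe_nndist, smul_eq_mul]

theorem isCompact_segment (P Q : E3) : IsCompact (segment ℝ P Q) := by
  rw [segment_eq_image_lineMap]
  exact isCompact_Icc.image AffineMap.lineMap_continuous

theorem setIntegral_biUnion_finset_ae {ι : Type*} [Countable ι] {X : Type*} [MeasurableSpace X] {μ : Measure X}
    {f : X → ℝ} (t : Finset ι) {s : ι → Set X} (hs : ∀ i ∈ t, MeasurableSet (s i))
    (hd : (t : Set ι).Pairwise fun i j => AEDisjoint μ (s i) (s j))
    (hf : ∀ i ∈ t, IntegrableOn f (s i) μ) :
    ∫ x in ⋃ i ∈ t, s i, f x ∂μ = ∑ i ∈ t, ∫ x in s i, f x ∂μ := by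
  classical
  induction t using Finset.induction_on with
  | empty => simp
  | insert i t hit ih =>
    have hd' : (t : Set ι).Pairwise fun i j => AEDisjoint μ (s i) (s j) :=
      hd.mono (by simp)
    have hs' : ∀ j ∈ t, MeasurableSet (s j) := fun j hj => hs j (Finset.mem_insert_of_mem hj)
    have hf' : ∀ j ∈ t, IntegrableOn f (s j) μ := fun j hj => hf j (Finset.mem_insert_of_mem hj)
    rw [Finset.set_biUnion_insert, Finset.sum_insert hit, ← ih hs' hd' hf']
    refine setIntegral_union₀ ?_ (Finset.measurableSet_biUnion _ hs').nullMeasurableSet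
      (hf i (Finset.mem_insert_self _ _)) (integrableOn_finset_iUnion.2 hf')
    simp only [AEDisjoint.iUnion_right_iff]
    exact fun j hj => hd (Finset.mem_coe.2 (Finset.mem_insert_self _ _))
      (Finset.mem_coe.2 (Finset.mem_insert_of_mem hj)) fun h => hit (h ▸ hj)

theorem subsingleton_segment_inter {P Q R S : E3}
    (h : R ∉ line[ℝ, P, Q] ∨ S ∉ line[ℝ, P, Q]) :
    (segment ℝ P Q ∩ segment ℝ R S).Subsingleton := by
  rintro x ⟨hx, hx'⟩ y ⟨hy, hy'⟩
  by_contra hne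
  have hle : segment ℝ P Q ⊆ line[ℝ, P, Q] := by
    intro z hz
    rw [segment_eq_image_lineMap] at hz
    obtain ⟨t, -, rfl⟩ := hz
    exact AffineMap.lineMap_mem_affineSpan_pair t P Q
  rw [segment_eq_image_lineMap] at hx' hy'
  obtain ⟨a, -, ha⟩ := hx'
  obtain ⟨b, -, hb⟩ := hy'
  have hab : b - a ≠ 0 := fun h0 => hne (by rw [← ha, ← hb, sub_eq_zero.1 h0])
  have hmem : ∀ t : ℝ, AffineMap.lineMap R S t ∈ line[ℝ, P, Q] := by
    intro t
    have : AffineMap.lineMap R S t = AffineMap.lineMap x y ((t - a) / (b - a)) := by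
      rw [← ha, ← hb]
      ext i
      simp [AffineMap.lineMap_apply_module]
      field_simp
      ring
    rw [this]
    exact AffineMap.lineMap_mem _ (hle hx) (hle hy)
  rcases h with h | h
  · exact h (by simpa using hmem 0)
  · exact h (by simpa using hmem 1)

/-- The vertices of the regular tetrahedron, indexed. -/
noncomputable def tetraVertex : Fin 4 → E3 := ![vA, vB, vC, vD]

/-- The eight vertices of the triakis tetrahedron; the flag selects the apices, which are the
tetrahedron vertices scaled by `c`. -/
noncomputable def triakisVertex (c : ℝ) (q : Fin 4 × Bool) : E3 :=
  (if q.2 then c else 1) • tetraVertex q.1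

/-- The index pairs of the eighteen edges. -/
def triakisEdges : Finset ((Fin 4 × Bool) × (Fin 4 × Bool)) :=
  Finset.univ.filter fun e => e.1.2 = false ∧
    ((e.2.2 = false ∧ e.1.1 < e.2.1) ∨ (e.2.2 = true ∧ e.1.1 ≠ e.2.1))

theorem edgeSet_eq_biUnion (r : ℝ) :
    edgeSet r = ⋃ e ∈ triakisEdges,
      segment ℝ (triakisVertex (-(r / 3)) e.1) (triakisVertex (-(r / 3)) e.2) := by
  have ha : va r = (-(r / 3)) • vA := by
    ext i; fin_cases i <;> simp [va, vA, pt]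
  have hb : vb r = (-(r / 3)) • vB := by
    ext i; fin_cases i <;> simp [vb, vB, pt]
  have hc : vc r = (-(r / 3)) • vC := by
    ext i; fin_cases i <;> simp [vc, vC, pt]
  have hd : vd r = (-(r / 3)) • vD := by
    ext i; fin_cases i <;> simp [vd, vD, pt]
  ext y
  simp only [edgeSet, ha, hb, hc, hd, triakisEdges, triakisVertex, tetraVertex,
    Finset.mem_filter, Finset.mem_univ, true_and, Set.mem_iUnion, Prod.exists, Fin.exists_fin_succ]
  simp
  tauto

theorem eq_of_sum_smul_tetraVertex_eq_zero {a : Fin 4 → ℝ}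
    (h : ∑ m, a m • tetraVertex m = 0) (i j : Fin 4) : a i = a j := by
  have h0 := congrArg (fun v : E3 => v 0) h
  have h1 := congrArg (fun v : E3 => v 1) h
  have h2 := congrArg (fun v : E3 => v 2) h
  simp [Fin.sum_univ_four, tetraVertex, vA, vB, vC, vD, pt] at h0 h1 h2
  fin_cases i <;> fin_cases j <;> simp <;> linarith

theorem triakisVertex_notMem_line {c : ℝ} (hc : c < 0) {i j k : Fin 4 × Bool} (hij : i ≠ j)
    (hik : i ≠ k) (hjk : j ≠ k) :
    triakisVertex c k ∉ line[ℝ, triakisVertex c i, triakisVertex c j] := by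
  rw [mem_affineSpan_pair_iff_exists_lineMap_eq]
  rintro ⟨t, ht⟩
  obtain ⟨i, a⟩ := i
  obtain ⟨j, b⟩ := j
  obtain ⟨k, d⟩ := k
  obtain ⟨m, hmi, hmj, hmk⟩ : ∃ m : Fin 4, m ≠ i ∧ m ≠ j ∧ m ≠ k := by
    have : ∀ i j k : Fin 4, ∃ m, m ≠ i ∧ m ≠ j ∧ m ≠ k := by decide
    exact this i j k
  set w : Bool → ℝ := fun b => if b then c else 1 with hw
  have hw0 : ∀ b, w b ≠ 0 := by
    intro b; cases b <;> simp [hw, hc.ne]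
  have hw1 : ∀ b d, b ≠ d → w b ≠ w d := by
    intro b d; cases b <;> cases d <;> simp [hw] <;> linarith
  obtain ⟨s, hs⟩ : ∃ s, s = 1 - t := ⟨_, rfl⟩
  let A : Fin 4 → ℝ := fun n => s * (if n = i then w a else 0) +
    t * (if n = j then w b else 0) - (if n = k then w d else 0)
  have hA : ∑ n, A n • tetraVertex n = 0 := by
    rw [AffineMap.lineMap_apply_module, ← hs] at ht
    simp only [A, sub_smul, add_smul, Finset.sum_sub_distrib, Finset.sum_add_distrib, mul_smul,
      ← Finset.smul_sum, ite_smul, zero_smul, Finset.sum_ite_eq', Finset.mem_univ, if_true]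
    exact sub_eq_zero.2 ht
  have hAm : A m = 0 := by simp [A, hmi, hmj, hmk]
  have hz : ∀ n, A n = 0 := fun n => (eq_of_sum_smul_tetraVertex_eq_zero hA n m).trans hAm
  have hi := hz i
  have hj := hz j
  have hk := hz k
  have h1 := hw0 a
  have h2 := hw0 b
  have h3 := hw0 d
  have h4 := hw1 a b
  have h5 := hw1 a d
  have h6 := hw1 b d
  simp only [A] at hi hj hk
  generalize w a = wa at *
  generalize w b = wb at *
  generalize w d = wd at *
  clear_value w
  clear hz hA ht hAm A hw0 hw1
  have hpigeon : a = b ∨ a = d ∨ b = d := by cases a <;> cases b <;> cases d <;> decide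
  by_cases e1 : i = j <;> by_cases e2 : i = k <;> by_cases e3 : j = k <;> grind

theorem exists_notMem_of_ne : ∀ e ∈ triakisEdges, ∀ e' ∈ triakisEdges, e ≠ e' →
    e.1 ≠ e.2 ∧ ((e'.1 ≠ e.1 ∧ e'.1 ≠ e.2) ∨ (e'.2 ≠ e.1 ∧ e'.2 ≠ e.2)) := by
  decide

theorem subsingleton_inter_of_mem_triakisEdges {c : ℝ} (hc : c < 0) {e e'}
    (he : e ∈ triakisEdges) (he' : e' ∈ triakisEdges) (hne : e ≠ e') :
    (segment ℝ (triakisVertex c e.1) (triakisVertex c e.2) ∩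
      segment ℝ (triakisVertex c e'.1) (triakisVertex c e'.2)).Subsingleton := by
  obtain ⟨h, h'⟩ := exists_notMem_of_ne e he e' he' hne
  refine subsingleton_segment_inter (h'.imp ?_ ?_) <;>
  exact fun ⟨h1, h2⟩ => triakisVertex_notMem_line hc h h1.symm h2.symm

theorem sum_triakisEdges {M : Type*} [AddCommMonoid M]
    (F : (Fin 4 × Bool) × (Fin 4 × Bool) → M) :
    ∑ e ∈ triakisEdges, F e =
      ∑ i, ∑ j, ((if i < j then F ((i, false), (j, false)) else 0) +
        (if i ≠ j then F ((i, false), (j, true)) else 0)) := by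
  simp [triakisEdges, Finset.sum_filter, Fintype.sum_prod_type, Fin.sum_univ_four]
  abel

theorem linForm_smul (c : ℝ) (v : E3) : linForm (c • v) = C c * linForm v := by
  simp [linForm, Finset.mul_sum, mul_assoc]

theorem linForm_tetraVertex (i : Fin 4) : linForm (tetraVertex i) = tetraForm i := by
  fin_cases i <;> simp [linForm, tetraVertex, tetraForm, vA, vB, vC, vD, pt, Fin.sum_univ_three]
  all_goals ring

theorem dist_tetraVertex_smul {i j : Fin 4} (h : i ≠ j) (c : ℝ) :
    dist (tetraVertex i) (c • tetraVertex j) = √(3 + 2 * c + 3 * c ^ 2) := by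
  rw [EuclideanSpace.dist_eq]
  congr 1
  fin_cases i <;> fin_cases j <;>
    first
    | exact absurd rfl h
    | simp [tetraVertex, vA, vB, vC, vD, pt, Fin.sum_univ_three, Real.dist_eq]
      ring

theorem sum_pow_mul_pow_reflect {R : Type*} [CommSemiring R] (x y : R) (k : ℕ) :
    ∑ a ∈ Finset.range (k + 1), x ^ a * y ^ (k - a) =
      ∑ a ∈ Finset.range (k + 1), x ^ (k - a) * y ^ a := by
  rw [← Finset.sum_range_reflect]
  refine Finset.sum_congr rfl fun a ha => ?_
  have := Finset.mem_range_succ_iff.1 ha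
  rw [show k + 1 - 1 - a = k - a by lia, Nat.sub_sub_self this]

theorem sum_ne_tetraForm_pow_mul_pow {k b : ℕ} (hb : b ≤ k) :
    ∑ i, ∑ j, (if i ≠ j then tetraForm i ^ (k - b) * tetraForm j ^ b else 0) =
      tetraPsum (k - b) * tetraPsum b - tetraPsum k := by
  have h : ∀ i, tetraForm i ^ k = tetraForm i ^ (k - b) * tetraForm i ^ b := fun i => by
    rw [← pow_add, Nat.sub_add_cancel hb]
  simp only [tetraPsum, h, Fin.sum_univ_four]
  simp
  ring

theorem sum_lt_tetraForm (k : ℕ) :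
    (2 : MvPolynomial (Fin 3) ℝ) * ∑ i, ∑ j, (if i < j then
      ∑ a ∈ Finset.range (k + 1), tetraForm i ^ a * tetraForm j ^ (k - a) else 0) =
      ∑ b ∈ Finset.range (k + 1), (tetraPsum (k - b) * tetraPsum b - tetraPsum k) := by
  have h : ∀ b ∈ Finset.range (k + 1), tetraPsum (k - b) * tetraPsum b - tetraPsum k =
      ∑ i, ∑ j, (if i ≠ j then tetraForm i ^ (k - b) * tetraForm j ^ b else 0) := fun b hb =>
    (sum_ne_tetraForm_pow_mul_pow (Finset.mem_range_succ_iff.1 hb)).symm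
  rw [Finset.sum_congr rfl h, Finset.sum_comm]
  simp_rw [Finset.sum_comm (s := Finset.range (k + 1))]
  have h2 : ∀ i j : Fin 4, ∑ b ∈ Finset.range (k + 1),
      (if i ≠ j then tetraForm i ^ (k - b) * tetraForm j ^ b else 0) =
      if i ≠ j then ∑ a ∈ Finset.range (k + 1), tetraForm i ^ a * tetraForm j ^ (k - a)
      else 0 := by
    intro i j
    split_ifs
    · rw [sum_pow_mul_pow_reflect]
    · simp
  simp_rw [h2]
  have h3 : ∀ i j : Fin 4, ∑ a ∈ Finset.range (k + 1), tetraForm i ^ a * tetraForm j ^ (k - a) =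
      ∑ a ∈ Finset.range (k + 1), tetraForm j ^ a * tetraForm i ^ (k - a) := by
    intro i j
    rw [sum_pow_mul_pow_reflect]
    exact Finset.sum_congr rfl fun _ _ => mul_comm _ _
  simp only [Fin.sum_univ_four]
  simp [h3 1 0, h3 2 0, h3 3 0, h3 2 1, h3 3 1, h3 3 2]
  ring

theorem sum_triakisEdges_eq_edgeMoment (c : ℝ) (k : ℕ) :
    ∑ e ∈ triakisEdges, C (dist (triakisVertex c e.1) (triakisVertex c e.2)) *
      (C (1 / ((k : ℝ) + 1)) * ∑ a ∈ Finset.range (k + 1),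
        linForm (triakisVertex c e.1) ^ a * linForm (triakisVertex c e.2) ^ (k - a)) =
      edgeMoment (√(3 + 2 * c + 3 * c ^ 2)) c k := by
  set l := √(3 + 2 * c + 3 * c ^ 2) with hl
  have h1 : ∀ i j : Fin 4, i < j →
      dist (triakisVertex c (i, false)) (triakisVertex c (j, false)) = 2 * √2 := by
    intro i j hij
    have := dist_tetraVertex_smul hij.ne 1
    rw [show (3 + 2 * 1 + 3 * 1 ^ 2 : ℝ) = 2 ^ 2 * 2 by norm_num,
      Real.sqrt_mul (by positivity), Real.sqrt_sq (by positivity), one_smul] at this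
    simpa [triakisVertex] using this
  have h2 : ∀ i j : Fin 4, i ≠ j →
      dist (triakisVertex c (i, false)) (triakisVertex c (j, true)) = l := by
    intro i j hij
    simpa [triakisVertex] using dist_tetraVertex_smul hij c
  have f1 : ∀ i, linForm (triakisVertex c (i, false)) = tetraForm i := fun i => by
    simp [triakisVertex, linForm_tetraVertex]
  have f2 : ∀ i, linForm (triakisVertex c (i, true)) = C c * tetraForm i := fun i => by
    simp [triakisVertex, linForm_tetraVertex, linForm_smul]
  have e1 : ∀ i j : Fin 4, (if i < j then
      C (dist (triakisVertex c (i, false)) (triakisVertex c (j, false))) *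
      (C (1 / ((k : ℝ) + 1)) * ∑ a ∈ Finset.range (k + 1),
        linForm (triakisVertex c (i, false)) ^ a * linForm (triakisVertex c (j, false)) ^ (k - a))
      else 0) = C (1 / ((k : ℝ) + 1)) * (C (√2) * (2 * if i < j then
        ∑ a ∈ Finset.range (k + 1), tetraForm i ^ a * tetraForm j ^ (k - a) else 0)) := by
    intro i j
    split_ifs with h
    · rw [h1 i j h, f1, f1, map_mul, show (C (2 : ℝ) : MvPolynomial (Fin 3) ℝ) = 2 from rfl]
      ring
    · simp
  have e2 : ∀ i j : Fin 4, (if i ≠ j then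
      C (dist (triakisVertex c (i, false)) (triakisVertex c (j, true))) *
      (C (1 / ((k : ℝ) + 1)) * ∑ a ∈ Finset.range (k + 1),
        linForm (triakisVertex c (i, false)) ^ a * linForm (triakisVertex c (j, true)) ^ (k - a))
      else 0) = C (1 / ((k : ℝ) + 1)) * ∑ b ∈ Finset.range (k + 1), C (l * c ^ b) *
        if i ≠ j then tetraForm i ^ (k - b) * tetraForm j ^ b else 0 := by
    intro i j
    split_ifs with h
    · rw [h2 i j h, f1, f2, sum_pow_mul_pow_reflect, mul_left_comm, Finset.mul_sum]
      congr 1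
      refine Finset.sum_congr rfl fun b _ => ?_
      simp only [map_mul, map_pow]
      ring
    · simp
  rw [sum_triakisEdges]
  simp only [e1, e2, Finset.sum_add_distrib, ← Finset.mul_sum]
  rw [sum_lt_tetraForm, edgeMoment, ← mul_add]
  congr 1
  simp_rw [Finset.sum_comm (t := Finset.range (k + 1)), ← Finset.mul_sum]
  rw [Finset.mul_sum, ← Finset.sum_add_distrib]
  refine Finset.sum_congr rfl fun b hb => ?_
  rw [sum_ne_tetraForm_pow_mul_pow (Finset.mem_range_succ_iff.1 hb), map_add]
  ring

theorem isCompact_edgeSet (r : ℝ) : IsCompact (edgeSet r) := by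
  rw [edgeSet_eq_biUnion]
  exact triakisEdges.isCompact_biUnion fun e _ => isCompact_segment _ _

theorem hausdorffMeasure_edgeSet_lt_top (r : ℝ) : μH[1] (edgeSet r) < ⊤ := by
  rw [edgeSet_eq_biUnion]
  refine (measure_biUnion_lt_top triakisEdges.finite_toSet fun e _ => ?_)
  rw [hausdorffMeasure_segment]
  exact edist_lt_top _ _

theorem hausdorffMeasure_edgeSet_pos (r : ℝ) : 0 < μH[1] (edgeSet r) := by
  have h : segment ℝ vA vB ⊆ edgeSet r := by
    intro y hy
    simp [edgeSet, hy]
  refine lt_of_lt_of_le ?_ (measure_mono h)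
  rw [hausdorffMeasure_segment, edist_pos]
  intro h0
  have := congrArg (fun v : E3 => v 0) h0
  norm_num [vA, vB, pt] at this

theorem setIntegral_edgeSet_dirDeriv_pow {r : ℝ} (hr : 0 < r) (g : smoothFn) (x : E3) (k : ℕ) :
    ∫ y in edgeSet r, ((dirDeriv y ^ k) g : E3 → ℝ) x ∂(μH[1]) =
      (smoothOp (edgeMoment (√((r ^ 2 - 2 * r + 9) / 3)) (-(r / 3)) k) g : E3 → ℝ) x := by
  have hF : Continuous fun y : E3 => ((dirDeriv y ^ k) g : E3 → ℝ) x :=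
    (continuous_dirDeriv_pow k g).comp (by fun_prop : Continuous fun y : E3 => (y, x))
  have hfin : ∀ e ∈ triakisEdges, μH[1]
      (segment ℝ (triakisVertex (-(r / 3)) e.1) (triakisVertex (-(r / 3)) e.2)) ≠ ⊤ := by
    intro e _
    rw [hausdorffMeasure_segment]
    exact edist_ne_top _ _
  have : NullSingletonClass (μH[1] : Measure E3) :=
    Measure.nullSingletonClass_hausdorff E3 one_pos
  rw [edgeSet_eq_biUnion, setIntegral_biUnion_finset_ae triakisEdges
    (fun e _ => (isCompact_segment _ _).measurableSet)
    (fun e he e' he' hne =>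
      (subsingleton_inter_of_mem_triakisEdges (by linarith) he he' hne).measure_zero _)
    (fun e he => hF.continuousOn.integrableOn_of_subset_isCompact (isCompact_segment _ _)
      (isCompact_segment _ _).measurableSet subset_rfl (hfin e he))]
  simp only [integral_segment _ _ hF, integral_dirDeriv_pow_lineMap]
  rw [show (r ^ 2 - 2 * r + 9) / 3 = 3 + 2 * (-(r / 3)) + 3 * (-(r / 3)) ^ 2 by ring,
    ← sum_triakisEdges_eq_edgeMoment, map_sum, LinearMap.sum_apply, Submodule.coe_sum,
    Finset.sum_apply]
  refine Finset.sum_congr rfl fun e _ => ?_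
  rw [← smul_eq_C_mul (_ * _), map_smul]
  rfl

theorem smoothOp_edgeMoment_eq_zero {r : ℝ} (hr : 0 < r) (g : smoothFn)
    (h : ∀ (x : E3) (s : ℝ), 0 < s → ∫ y in edgeSet r, (g : E3 → ℝ) (x + s • y) ∂(μH[1]) =
      (g : E3 → ℝ) x * (μH[1] (edgeSet r)).toReal) (k : ℕ) (hk : k ≠ 0) :
    smoothOp (edgeMoment (√((r ^ 2 - 2 * r + 9) / 3)) (-(r / 3)) k) g = 0 := by
  have : IsFiniteMeasure ((μH[1] : Measure E3).restrict (edgeSet r)) :=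
    isFiniteMeasure_restrict.2 (hausdorffMeasure_edgeSet_lt_top r).ne
  refine Subtype.ext (funext fun x => ?_)
  rw [← setIntegral_edgeSet_dirDeriv_pow hr]
  exact integral_dirDeriv_pow_eq_zero (isCompact_edgeSet r)
    (ae_restrict_mem (isCompact_edgeSet r).measurableSet) g x _ (h x) k hk

theorem meanValue_of_smoothOp_edgeMoment {r : ℝ} (hr : 0 < r) (g : smoothFn)
    (hX : ∀ i, smoothOp (X i ^ 6) g = 0)
    (h : ∀ k ≠ 0, smoothOp (edgeMoment (√((r ^ 2 - 2 * r + 9) / 3)) (-(r / 3)) k) g = 0)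
    (x : E3) (s : ℝ) :
    ∫ y in edgeSet r, (g : E3 → ℝ) (x + s • y) ∂(μH[1]) =
      (g : E3 → ℝ) x * (μH[1] (edgeSet r)).toReal := by
  have : IsFiniteMeasure ((μH[1] : Measure E3).restrict (edgeSet r)) :=
    isFiniteMeasure_restrict.2 (hausdorffMeasure_edgeSet_lt_top r).ne
  rw [integral_line_eq_of_X_pow_six (isCompact_edgeSet r)
    (ae_restrict_mem (isCompact_edgeSet r).measurableSet) g hX x fun k hk => ?_]
  · rw [measureReal_restrict_apply_univ, Measure.real]
  · rw [setIntegral_edgeSet_dirDeriv_pow hr, h k hk]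
    rfl

/-- The mean value property over the edges, expressed through an ideal membership criterion for the
moment polynomials. -/
theorem meanValue_edgeSet_iff {r : ℝ} (hr : 0 < r) {Q : Ideal (MvPolynomial (Fin 3) ℝ) → Prop}
    (hQ : ∀ I : Ideal (MvPolynomial (Fin 3) ℝ),
      (∀ k ≠ 0, edgeMoment (√((r ^ 2 - 2 * r + 9) / 3)) (-(r / 3)) k ∈ I) ↔ Q I)
    (hQX : ∀ I, Q I → ∀ i, (X i : MvPolynomial (Fin 3) ℝ) ^ 6 ∈ I)
    {f : E3 → ℝ} (hf : Continuous f) :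
    (∀ (x : E3) (s : ℝ), 0 < s →
        f x = (∫ y in edgeSet r, f (x + s • y) ∂(μH[1])) / (μH[1] (edgeSet r)).toReal) ↔
      ∃ p : MvPolynomial (Fin 3) ℝ,
        Q (annIdeal (fun i => dirDeriv (EuclideanSpace.single i 1))
          (fun _ _ => commute_dirDeriv _ _) (polyFn p)) ∧ ∀ x, f x = eval (toFn x) p := by
  have hM : (μH[1] (edgeSet r)).toReal ≠ 0 := (ENNReal.toReal_pos
    (hausdorffMeasure_edgeSet_pos r).ne' (hausdorffMeasure_edgeSet_lt_top r).ne).ne'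
  have : IsFiniteMeasure ((μH[1] : Measure E3).restrict (edgeSet r)) :=
    isFiniteMeasure_restrict.2 (hausdorffMeasure_edgeSet_lt_top r).ne
  have key : ∀ g : smoothFn, (∀ (x : E3) (s : ℝ), 0 < s →
      ∫ y in edgeSet r, (g : E3 → ℝ) (x + s • y) ∂(μH[1]) =
        (g : E3 → ℝ) x * (μH[1] (edgeSet r)).toReal) →
      Q (annIdeal (fun i => dirDeriv (EuclideanSpace.single i 1))
          (fun _ _ => commute_dirDeriv _ _) g) := fun g hg =>
    (hQ _).1 fun k hk => smoothOp_edgeMoment_eq_zero hr g hg k hk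
  constructor
  · intro h
    have h' : ∀ (x : E3) (s : ℝ), 0 < s → ∫ y in edgeSet r, f (x + s • y) ∂(μH[1]) =
        f x * (μH[1] (edgeSet r)).toReal := fun x s hs => by
      rw [h x s hs, div_mul_cancel₀ _ hM]
    obtain ⟨p, rfl⟩ := exists_eval_of_mem_boxPoly (mem_boxPoly_of_mollify hf fun φ =>
      mem_boxPoly_of_X_pow_six _ (hQX _ (key _ (integral_mollify (isCompact_edgeSet r)
        (ae_restrict_mem (isCompact_edgeSet r).measurableSet) φ hf _ h'))))
    exact ⟨p, key _ h', fun x => rfl⟩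
  · rintro ⟨p, hp, hfp⟩ x s -
    obtain rfl : f = polyFn p := funext hfp
    rw [meanValue_of_smoothOp_edgeMoment hr (polyFn p) (hQX _ hp) ((hQ _).2 hp),
      mul_div_cancel_right₀ _ hM]

theorem triakisTetrahedron_edge_harmonics
    (r : ℝ) (hr : 0 < r)
    (r₁ : ℝ) (hr₁pos : 0 < r₁)
    (hr₁root : r₁ ^ 6 + 2 * r₁ ^ 5 + r₁ ^ 4 - 36 * r₁ ^ 3 - 45 * r₁ ^ 2 - 270 * r₁ - 405 = 0)
    (hr₁uniq : ∀ y : ℝ, 0 < y →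
      y ^ 6 + 2 * y ^ 5 + y ^ 4 - 36 * y ^ 3 - 45 * y ^ 2 - 270 * y - 405 = 0 → y = r₁)
    (f : E3 → ℝ) (hf : Continuous f) :
    (∀ (x : E3) (s : ℝ), 0 < s →
        f x = (∫ y in edgeSet r, f (x + s • y) ∂(μH[1])) / (μH[1] (edgeSet r)).toReal) ↔
      ((r = r₁ → ∃ p : MvPolynomial (Fin 3) ℝ,
          dop e2 p = 0 ∧ dop e4 p = 0 ∧ dop e6 p = 0 ∧ ∀ x, f x = eval (toFn x) p) ∧
       (r ≠ r₁ → ∃ p : MvPolynomial (Fin 3) ℝ,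
          dop e2 p = 0 ∧ dop e3 p = 0 ∧ dop e4 p = 0 ∧ ∀ x, f x = eval (toFn x) p)) := by
  have hl : 0 < √((r ^ 2 - 2 * r + 9) / 3) :=
    Real.sqrt_pos.2 (by nlinarith [sq_nonneg (r - 1)])
  have hc : -(r / 3) < 0 := by linarith
  have hiff := cubic_coeff_eq_zero_iff hr hr₁pos hr₁root hr₁uniq
  simp only [dop_eq_zero_iff]
  by_cases h : r = r₁
  · simp only [h, true_imp_iff, ne_eq, not_true, false_imp_iff, and_true]
    rw [← h, meanValue_edgeSet_iff hr
      (fun I => forall_edgeMoment_mem_iff_of_eq_zero hl hc (hiff.2 h))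
      (fun I hI => X_pow_six_mem hI.1 hI.2.1 hI.2.2) hf]
    simp only [and_assoc]
    rfl
  · simp only [h, ne_eq, not_false_eq_true, true_imp_iff, false_imp_iff, true_and]
    rw [meanValue_edgeSet_iff hr
      (fun I => forall_edgeMoment_mem_iff hl hc (fun h0 => h (hiff.1 h0)))
      (fun I hI => X_pow_six_mem hI.1 hI.2.2
        (by rw [e6_eq, sq]; exact I.mul_mem_left _ hI.2.1)) hf]
    simp only [and_assoc]
    rfl
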